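/- There are absolute constants c₀ ≥ 10 and κ > 0 such that for every real c ≥ c₀ the following holds. Let m be a sufficiently large integer and let n = (1 − ε)·m be an integer with m^{−1/3} ≤ ε ≤ 1/c. Fix any history-independent insertion/deletion model at size n on m slots. Draw r uniform in {⌈n/4⌉, …, ⌊n/2⌋}, start from A ∼ 𝒞_n, and perform an insertion at rank r followed by a deletion at rank n+1. Then the expected total cost of the two operations is at least κ·Σ_{j ∈ J} 1/(Δ_j + 1/j). -/

import Mathlib

open scoped BigOperators Classical

/-- Read slot `i` (mod `m`) of a cyclic array of `m` boolean slots. -/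
def cyc (m : ℕ) (A : Fin m → Bool) (i : ℕ) : Bool :=
  if h : 0 < m then A ⟨i % m, Nat.mod_lt i h⟩ else false

/-- Number of occupied slots among the `j` cyclically consecutive slots
`p, p+1, …, p+j-1`. -/
def blockCount (m : ℕ) (A : Fin m → Bool) (p j : ℕ) : ℕ :=
  ((Finset.range j).filter (fun t => cyc m A (p + t) = true)).card

/-- Density of the `j`-block starting at slot `p`. -/
noncomputable def blockDensity (m : ℕ) (A : Fin m → Bool) (p j : ℕ) : ℝ :=
  (blockCount m A p j : ℝ) / j

/-- A block is live (w.r.t. constant `c` and sparsity `ε`) if its density is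
at least `1 - c·ε`. -/
def IsLive (c ε : ℝ) (m : ℕ) (A : Fin m → Bool) (p j : ℕ) : Prop :=
  1 - c * ε ≤ blockDensity m A p j

/-- Imbalance of a `j`-block (for even `j`): difference of the densities of its
two halves. -/
noncomputable def imbalance (m : ℕ) (A : Fin m → Bool) (p j : ℕ) : ℝ :=
  |blockDensity m A p (j / 2) - blockDensity m A (p + j / 2) (j / 2)|

/-- Adjusted imbalance: the imbalance if the block is live, `0` if it is dead. -/
noncomputable def adjImbalance (c ε : ℝ) (m : ℕ) (A : Fin m → Bool) (p j : ℕ) : ℝ :=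
  if IsLive c ε m A p j then imbalance m A p j else 0

/-- `Δ_j(A)`: the average adjusted imbalance over all `m` `j`-blocks. -/
noncomputable def DeltaAvg (c ε : ℝ) (m : ℕ) (A : Fin m → Bool) (j : ℕ) : ℝ :=
  (∑ p ∈ Finset.range m, adjImbalance c ε m A p j) / m

/-- `J = {2, 4, 8, …, 2^(⌊log₂ m⌋ - 2)}`. -/
def Jset (m : ℕ) : Finset ℕ := (Finset.Icc 1 (Nat.log 2 m - 2)).image (fun i => 2 ^ i)

/-- The potential `φ` of a `j`-block: `0` if dead, `(μ - (1 - c·ε))²` if live,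
where `μ` is its density. -/
noncomputable def potential (c ε : ℝ) (m : ℕ) (A : Fin m → Bool) (p j : ℕ) : ℝ :=
  if IsLive c ε m A p j then (blockDensity m A p j - (1 - c * ε)) ^ 2 else 0

/-- An array configuration on `m` slots with `k` elements: a boolean occupancy
vector with exactly `k` occupied slots. -/
abbrev Config (m k : ℕ) :=
  {A : Fin m → Bool // (Finset.univ.filter (fun i => A i = true)).card = k}

/-- Expectation of a real-valued function under a probability mass function on a
finite type. -/
noncomputable def pexp {α : Type*} [Fintype α] (p : PMF α) (f : α → ℝ) : ℝ :=
  ∑ a, (p a).toReal * f a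

/-- Probability of an event under a probability mass function on a finite type. -/
noncomputable def pprob {α : Type*} [Fintype α] (p : PMF α) (E : α → Prop) : ℝ :=
  pexp p (fun a => if E a then 1 else 0)

/-- `posOf A s` is the position (0-indexed slot) of the rank-`s` element of `A`,
i.e. the `s`-th smallest occupied slot (`s` is 1-indexed). -/
def posOf {m : ℕ} (A : Fin m → Bool) (s : ℕ) : ℕ :=
  (((List.range m).filter (fun i => cyc m A i))).getD (s - 1) 0

/-- A history-independent insertion/deletion model at size `n` on `m` slots:
distributions `C0` (on `n`-element configurations) and `C1` (on `(n+1)`-element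
configurations), insertion couplings `ins r` for each rank `r ∈ {1, …, n+1}`,
and a deletion coupling `del` for rank `n+1`, all with marginals `C0` and `C1`. -/
structure HIModel (m n : ℕ) where
  C0 : PMF (Config m n)
  C1 : PMF (Config m (n + 1))
  ins : ℕ → PMF (Config m n × Config m (n + 1))
  del : PMF (Config m n × Config m (n + 1))
  ins_fst : ∀ r, 1 ≤ r → r ≤ n + 1 → PMF.map Prod.fst (ins r) = C0
  ins_snd : ∀ r, 1 ≤ r → r ≤ n + 1 → PMF.map Prod.snd (ins r) = C1
  del_fst : PMF.map Prod.fst del = C0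
  del_snd : PMF.map Prod.snd del = C1

/-- The coupling `p` conditioned on its first coordinate being `A` (junk value
`p` itself when the conditioning event is null; such states are reached with
probability zero). -/
noncomputable def condFst {m n : ℕ} (p : PMF (Config m n × Config m (n + 1)))
    (A : Config m n) : PMF (Config m n × Config m (n + 1)) :=
  if h : ∃ q ∈ {q : Config m n × Config m (n + 1) | q.1 = A}, q ∈ p.support then
    p.filter {q | q.1 = A} h
  else p

/-- The coupling `p` conditioned on its second coordinate being `A'`. -/
noncomputable def condSnd {m n : ℕ} (p : PMF (Config m n × Config m (n + 1)))
    (A' : Config m (n + 1)) : PMF (Config m n × Config m (n + 1)) :=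
  if h : ∃ q ∈ {q : Config m n × Config m (n + 1) | q.2 = A'}, q ∈ p.support then
    p.filter {q | q.2 = A'} h
  else p

/-- Rank of an old element after an insertion at rank `r`. -/
def insShift (r s : ℕ) : ℕ := if s < r then s else s + 1

/-- The (cyclic) slots of the 1st, `(j/2)`-th and `j`-th positions of the
`j`-block starting at slot `p`: the slots of the boundary set `B(x)`. -/
def boundarySlots (m p j : ℕ) : Finset ℕ :=
  {p % m, (p + j / 2 - 1) % m, (p + j - 1) % m}

/-- An insertion at rank `r` realized by the pair `(A0, A1)` is critical to the
`j`-block of `A0` starting at slot `p`: the block is live in `A0` and some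
element of its boundary set is rearranged. -/
def InsCritical (c : ℝ) (m n r j p : ℕ) (A0 : Config m n) (A1 : Config m (n + 1)) : Prop :=
  IsLive c (1 - (n : ℝ) / m) m A0.1 p j ∧
  ∃ s ∈ Finset.Icc 1 n, posOf A0.1 s ∈ boundarySlots m p j ∧
    posOf A0.1 s ≠ posOf A1.1 (insShift r s)

/-- A deletion at rank `n+1` realized by the pair `(A0, A1)` (`A1` before, `A0`
after) is critical to the `j`-block of `A1` starting at slot `p`. -/
def DelCritical (c : ℝ) (m n j p : ℕ) (A0 : Config m n) (A1 : Config m (n + 1)) : Prop :=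
  IsLive c (1 - ((n : ℝ) + 1) / m) m A1.1 p j ∧
  ∃ s ∈ Finset.Icc 1 n, posOf A1.1 s ∈ boundarySlots m p j ∧
    posOf A1.1 s ≠ posOf A0.1 s

/-- Probability that, starting from configuration `A` and performing `k`
insertion/deletion pairs (insertion at rank `r`, deletion at rank `n+1`),
no operation is critical to the `j`-block starting at the position of the
current rank-`t` element (in the configuration just before that operation). -/
noncomputable def probNoCrit (c : ℝ) {m n : ℕ} (Mo : HIModel m n) (t r j : ℕ) :
    ℕ → Config m n → ℝ
  | 0, _ => 1
  | k + 1, A =>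
      pexp (condFst (Mo.ins r) A) fun q =>
        if InsCritical c m n r j (posOf q.1.1 t) q.1 q.2 then 0
        else pexp (condSnd Mo.del q.2) fun q' =>
          if DelCritical c m n j (posOf q'.2.1 t) q'.1 q'.2 then 0
          else probNoCrit c Mo t r j k q'.1

/-- `Δ_j` for the stationary distribution `C0` of a model. -/
noncomputable def DeltaExp (c : ℝ) {m n : ℕ} (Mo : HIModel m n) (j : ℕ) : ℝ :=
  pexp Mo.C0 (fun A => DeltaAvg c (1 - (n : ℝ) / m) m A.1 j)

/-- Cost of an insertion at rank `r` realized by the pair `(A0, A1)`: one plus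
the number of rearranged elements. -/
noncomputable def insCost (m n r : ℕ) (A0 : Config m n) (A1 : Config m (n + 1)) : ℕ :=
  1 + ((Finset.Icc 1 n).filter
        (fun s => posOf A0.1 s ≠ posOf A1.1 (insShift r s))).card

/-- Cost of a deletion at rank `n+1` realized by the pair `(A0, A1)` (`A1`
before, `A0` after): one plus the number of rearranged elements. -/
noncomputable def delCost (m n : ℕ) (A0 : Config m n) (A1 : Config m (n + 1)) : ℕ :=
  1 + ((Finset.Icc 1 n).filter (fun s => posOf A1.1 s ≠ posOf A0.1 s)).card

/-- Expected total cost of an insertion at rank `r` (starting from `A ∼ C0`)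
followed by a deletion at rank `n+1`. -/
noncomputable def expPairCost {m n : ℕ} (Mo : HIModel m n) (r : ℕ) : ℝ :=
  pexp Mo.C0 (fun A =>
    pexp (condFst (Mo.ins r) A) (fun q =>
      (insCost m n r q.1 q.2 : ℝ) +
        pexp (condSnd Mo.del q.2) (fun q' => (delCost m n q'.1 q'.2 : ℝ))))

/-- Number of occupied slots among `0, …, x-1` (periodic extension). -/
def cnt {m : ℕ} (A : Fin m → Bool) (x : ℕ) : ℕ :=
  Nat.count (fun i => cyc m A i = true) x

lemma cnt_succ {m : ℕ} (A : Fin m → Bool) (x : ℕ) :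
    cnt A (x+1) = cnt A x + if cyc m A x = true then 1 else 0 := by
  unfold cnt; rw [Nat.count_succ]

lemma cnt_add {m : ℕ} (A : Fin m → Bool) (p j : ℕ) :
    cnt A (p + j) = cnt A p + blockCount m A p j := by
  unfold cnt blockCount
  rw [Nat.count_add, Nat.count_eq_card_filter_range (fun k => cyc m A (p+k) = true)]

lemma blockCount_le {m : ℕ} (A : Fin m → Bool) (p j : ℕ) : blockCount m A p j ≤ j := by
  unfold blockCount
  exact (Finset.card_filter_le _ _).trans (by simp)

lemma cnt_config {m k : ℕ} (A : Config m k) : cnt A.1 m = k := by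
  have h := A.2
  unfold cnt
  rw [Nat.count_eq_card_filter_range]
  refine Eq.trans ?_ h
  symm
  apply Finset.card_bij (fun (i : Fin m) _ => (i : ℕ))
  · intro i hi
    have hm : 0 < m := i.pos
    simp only [Finset.mem_filter, Finset.mem_univ, true_and] at hi
    simp [cyc, hm, Nat.mod_eq_of_lt i.2, hi]
  · intro i _ j _ h
    exact Fin.ext h
  · intro b hb
    simp only [Finset.mem_filter, Finset.mem_range] at hb
    refine ⟨⟨b, hb.1⟩, ?_, rfl⟩
    have h2 := hb.2
    have hm : 0 < m := by omega
    simpa [cyc, hm, Nat.mod_eq_of_lt hb.1] using h2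

lemma list_aux (P : ℕ → Bool) (m : ℕ) :
    ((List.range m).filter P).length = Nat.count (fun i => P i = true) m ∧
    ∀ i, i < Nat.count (fun i => P i = true) m →
      ((List.range m).filter P).getD i 0 < m ∧
      P (((List.range m).filter P).getD i 0) = true ∧
      Nat.count (fun i => P i = true) (((List.range m).filter P).getD i 0) = i := by
  induction m with
  | zero => simp
  | succ m ih =>
    obtain ⟨ih1, ih2⟩ := ih
    rw [List.range_succ, List.filter_append, Nat.count_succ]
    by_cases h : P m = true
    · simp only [h, List.filter_cons_of_pos, List.filter_nil, if_true, List.length_append, ih1,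
        List.length_singleton, true_and]
      intro i hi
      by_cases h2 : i < Nat.count (fun i => P i = true) m
      · rw [List.getD_append _ _ _ _ (by rw [ih1]; exact h2)]
        obtain ⟨a, b, c⟩ := ih2 i h2
        exact ⟨by omega, b, c⟩
      · have : i = Nat.count (fun i => P i = true) m := by omega
        rw [List.getD_append_right _ _ _ _ (by rw [ih1]; omega), ih1, this]
        simp [h]
    · simp only [h]
      simp only [Bool.not_eq_true] at h
      simp only [List.filter_cons, h, List.filter_nil]
      simp only [Bool.false_eq_true, if_false, add_zero]
      refine ⟨by simpa using ih1, fun i hi => ?_⟩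
      obtain ⟨a, b, c⟩ := ih2 i hi
      simp only [List.append_nil]
      exact ⟨by omega, b, c⟩

lemma posOf_spec {m : ℕ} (A : Fin m → Bool) (s : ℕ) (h1 : 1 ≤ s) (h2 : s ≤ cnt A m) :
    posOf A s < m ∧ cyc m A (posOf A s) = true ∧ cnt A (posOf A s) + 1 = s := by
  obtain ⟨a, b, c⟩ := (list_aux (fun i => cyc m A i) m).2 (s-1) (by unfold cnt at h2; omega)
  refine ⟨a, b, ?_⟩
  unfold cnt posOf
  omega

lemma cnt_mono {m : ℕ} (A : Fin m → Bool) {x y : ℕ} (h : x ≤ y) : cnt A x ≤ cnt A y :=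
  Nat.count_monotone _ h

lemma posOf_cnt {m : ℕ} (A : Fin m → Bool) (x : ℕ) (hx : x < m) (h : cyc m A x = true) :
    posOf A (cnt A (x+1)) = x := by
  have e := cnt_succ A x
  simp only [h, if_true] at e
  obtain ⟨a, b, c⟩ := posOf_spec A (cnt A (x+1)) (by omega) (cnt_mono A hx)
  exact Nat.count_injective (p := fun i => cyc m A i = true) b h (by unfold cnt at *; omega)

lemma posOf_inj {m : ℕ} (A : Fin m → Bool) {s s' : ℕ} (h1 : 1 ≤ s) (h2 : s ≤ cnt A m)
    (h1' : 1 ≤ s') (h2' : s' ≤ cnt A m) (h : posOf A s = posOf A s') : s = s' := by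
  have a := (posOf_spec A s h1 h2).2.2
  have b := (posOf_spec A s' h1' h2').2.2
  rw [h] at a; omega

lemma card_shift {m : ℕ} (A : Fin m → Bool) (t : ℕ) :
    ((Finset.range m).filter (fun p => cyc m A (p + t) = true)).card = cnt A m := by
  have hp : Function.Periodic (fun i => cyc m A i = true) m := by
    intro x; simp [cyc]
  have := Nat.filter_Ico_card_eq_of_periodic t m _ hp
  unfold cnt
  rw [← this]
  apply Finset.card_bij (fun p _ => p + t)
  · intro a ha
    simp only [Finset.mem_filter, Finset.mem_range, Finset.mem_Ico] at ha ⊢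
    exact ⟨by omega, ha.2⟩
  · intro a _ b _ h; omega
  · intro b hb
    simp only [Finset.mem_filter, Finset.mem_range, Finset.mem_Ico] at hb ⊢
    exact ⟨b - t, ⟨by omega, by rw [Nat.sub_add_cancel hb.1.1]; exact hb.2⟩, by omega⟩

lemma sum_blockCount {m : ℕ} (A : Fin m → Bool) (j : ℕ) :
    ∑ p ∈ Finset.range m, blockCount m A p j = j * cnt A m := by
  simp only [blockCount, Finset.card_filter]
  rw [Finset.sum_comm]
  simp only [← Finset.card_filter, card_shift]
  simp

/-- Signed difference of the counts of the two halves of the `8q`-block at `p`. -/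
def dif {m : ℕ} (A : Fin m → Bool) (q p : ℕ) : ℤ :=
  (blockCount m A p (4*q) : ℤ) - blockCount m A (p + 4*q) (4*q)

def GoodP {m : ℕ} (A : Fin m → Bool) (q p : ℕ) : Prop :=
  cyc m A (p + (4*q-1)) = true ∧ cyc m A (p + (8*q-1)) = true ∧ 3*q ≤ blockCount m A p (4*q)

def Good {m : ℕ} (A : Fin m → Bool) (q t : ℕ) : Prop := GoodP A q (posOf A t)

noncomputable def Fpot {m : ℕ} (K : ℤ) (A : Fin m → Bool) (q t : ℕ) : ℤ :=
  if Good A q t then max (-K) (min K (dif A q (posOf A t))) else -K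

def Crit {m : ℕ} (A : Fin m → Bool) (q t : ℕ) (W : ℕ → Prop) : Prop :=
  W t ∨ W (cnt A (posOf A t + 4*q)) ∨ W (cnt A (posOf A t + 8*q))

lemma Fpot_bound {m : ℕ} (K : ℤ) (hK : 0 ≤ K) (A : Fin m → Bool) (q t : ℕ) :
    -K ≤ Fpot K A q t ∧ Fpot K A q t ≤ K := by
  unfold Fpot; split_ifs <;> omega

/-- basic geometric facts -/
lemma geo {m : ℕ} (A : Fin m → Bool) (q t : ℕ) (ht : 1 ≤ t) (htn : t + 8*q ≤ cnt A m + 1)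
    (hq : 1 ≤ q) : posOf A t + 8*q ≤ m ∧ cyc m A (posOf A t) = true ∧
      cnt A (posOf A t) + 1 = t := by
  obtain ⟨a, b, c⟩ := posOf_spec A t ht (by omega)
  refine ⟨?_, b, c⟩
  have e := cnt_add A (posOf A t) (m - posOf A t)
  have := blockCount_le A (posOf A t) (m - posOf A t)
  rw [Nat.add_sub_cancel' a.le] at e
  omega

lemma dif_eq {m : ℕ} (A : Fin m → Bool) (q p : ℕ) :
    dif A q p = 2 * (cnt A (p+4*q) : ℤ) - cnt A p - cnt A (p + 8*q) := by
  have a := cnt_add A p (4*q)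
  have b := cnt_add A (p+4*q) (4*q)
  rw [show p + 4*q+4*q = p+8*q by ring] at b
  unfold dif; omega

/-- Transfer of goodness when the three boundary elements do not move. -/
lemma transfer {m : ℕ} (A B : Fin m → Bool) (q t e : ℕ) (hq : 1 ≤ q) (ht : 1 ≤ t)
    (htn : t + 8*q ≤ cnt A m + 1) (htB : t + 8*q + e ≤ cnt B m + 1) (hG : Good A q t)
    (h1 : posOf A t = posOf B t)
    (h2 : posOf A (cnt A (posOf A t + 4*q)) = posOf B (cnt A (posOf A t + 4*q) + e))
    (h3 : posOf A (cnt A (posOf A t + 8*q)) = posOf B (cnt A (posOf A t + 8*q) + e)) :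
    Good B q t ∧ dif B q (posOf B t) = dif A q (posOf A t) + e := by
  obtain ⟨g1, g2, g3⟩ := geo A q t ht htn hq
  obtain ⟨G1, G2, G3⟩ := hG
  set p := posOf A t with hp
  have c4 := cnt_add A p (4*q)
  have c8 := cnt_add A p (8*q)
  have l8 := blockCount_le A p (8*q)
  have c48 : cnt A (p+4*q) ≤ cnt A (p+8*q) := cnt_mono A (by omega)
  have x2 := posOf_cnt A (p + (4*q-1)) (by omega) G1
  have x3 := posOf_cnt A (p + (8*q-1)) (by omega) G2
  rw [show p + (4*q-1)+1 = p + 4*q by omega] at x2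
  rw [show p + (8*q-1)+1 = p + 8*q by omega] at x3
  rw [x2] at h2
  rw [x3] at h3
  obtain ⟨_, b1, d1⟩ := posOf_spec B t ht (by omega)
  obtain ⟨_, b2, d2⟩ := posOf_spec B (cnt A (p + 4*q) + e) (by omega) (by omega)
  obtain ⟨_, b3, d3⟩ := posOf_spec B (cnt A (p + 8*q) + e) (by omega) (by omega)
  rw [← h1] at b1 d1
  rw [← h2] at b2 d2
  rw [← h3] at b3 d3
  have s2 := cnt_succ B (p + (4*q-1))
  have s3 := cnt_succ B (p + (8*q-1))
  rw [show p + (4*q-1)+1 = p + 4*q by omega, if_pos b2] at s2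
  rw [show p + (8*q-1)+1 = p + 8*q by omega, if_pos b3] at s3
  have c4' := cnt_add B p (4*q)
  refine ⟨?_, ?_⟩
  · unfold Good GoodP
    rw [← h1]
    exact ⟨b2, b3, by omega⟩
  · rw [← h1, dif_eq, dif_eq]
    push_cast
    omega

def Wins {m : ℕ} (r : ℕ) (A B : Fin m → Bool) (s : ℕ) : Prop := posOf A s ≠ posOf B (insShift r s)
def Wdel {m : ℕ} (A B : Fin m → Bool) (s : ℕ) : Prop := posOf B s ≠ posOf A s

lemma ins_point {m n : ℕ} (A : Config m n) (B : Config m (n+1)) (q t d r : ℕ) (K : ℤ) (hK : 0 ≤ K)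
    (hq : 1 ≤ q) (ht : 1 ≤ t) (htn : t + 8*q ≤ n + 1) (hr : t + d = r) (hd : q ≤ d) (hd2 : d < 2*q) :
    (if Good A.1 q t ∧ |dif A.1 q (posOf A.1 t)| < K then (1:ℤ) else 0) ≤
      (Fpot K B.1 q t - Fpot K A.1 q t) +
      (2*K+1) * (if Good A.1 q t ∧ Crit A.1 q t (Wins r A.1 B.1) then 1 else 0) := by
  have hA := cnt_config A
  have hB := cnt_config B
  have fA := Fpot_bound K hK A.1 q t
  have fB := Fpot_bound K hK B.1 q t
  by_cases hG : Good A.1 q t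
  · by_cases hC : Crit A.1 q t (Wins r A.1 B.1)
    · rw [if_pos (⟨hG, hC⟩ : _ ∧ _)]
      split_ifs <;> omega
    · have hC' := hC
      unfold Crit Wins at hC
      push Not at hC
      obtain ⟨h1, h2, h3⟩ := hC
      obtain ⟨g1, g2, g3⟩ := geo A.1 q t ht (by omega) hq
      have c4 := cnt_add A.1 (posOf A.1 t) (4*q)
      have c48 : cnt A.1 (posOf A.1 t+4*q) ≤ cnt A.1 (posOf A.1 t+8*q) := cnt_mono _ (by omega)
      have hG3 := hG.2.2
      have i1 : insShift r t = t := by unfold insShift; rw [if_pos (by omega)]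
      have i2 : insShift r (cnt A.1 (posOf A.1 t+4*q)) = cnt A.1 (posOf A.1 t+4*q) + 1 := by
        unfold insShift; rw [if_neg (by omega)]
      have i3 : insShift r (cnt A.1 (posOf A.1 t+8*q)) = cnt A.1 (posOf A.1 t+8*q) + 1 := by
        unfold insShift; rw [if_neg (by omega)]
      rw [i1] at h1
      rw [i2] at h2
      rw [i3] at h3
      obtain ⟨T1, T2⟩ := transfer A.1 B.1 q t 1 hq ht (by omega) (by omega) hG h1 h2 h3
      have e1 : Fpot K A.1 q t = max (-K) (min K (dif A.1 q (posOf A.1 t))) := if_pos hG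
      have e2 : Fpot K B.1 q t = max (-K) (min K (dif B.1 q (posOf B.1 t))) := if_pos T1
      rw [e1, e2, T2]
      push_cast
      simp only [hC', and_false, if_false, hG, true_and, abs_lt]
      split_ifs <;> omega
  · have e1 : Fpot K A.1 q t = -K := if_neg hG
    simp only [hG, false_and, if_false]
    omega

lemma del_point {m n : ℕ} (A : Config m n) (B : Config m (n+1)) (q t : ℕ) (K : ℤ) (hK : 0 ≤ K)
    (hq : 1 ≤ q) (ht : 1 ≤ t) (htn : t + 8*q ≤ n + 1)  :
    0 ≤ (Fpot K A.1 q t - Fpot K B.1 q t) +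
      (2*K+1) * (if Good B.1 q t ∧ Crit B.1 q t (Wdel A.1 B.1) then 1 else 0) := by
  have hA := cnt_config A
  have hB := cnt_config B
  have fA := Fpot_bound K hK A.1 q t
  have fB := Fpot_bound K hK B.1 q t
  by_cases hG : Good B.1 q t
  · by_cases hC : Crit B.1 q t (Wdel A.1 B.1)
    · rw [if_pos (⟨hG, hC⟩ : _ ∧ _)]
      omega
    · have hC' := hC
      unfold Crit Wdel at hC
      push Not at hC
      obtain ⟨h1, h2, h3⟩ := hC
      obtain ⟨T1, T2⟩ := transfer B.1 A.1 q t 0 hq ht (by omega) (by omega) hG h1 h2 h3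
      have e1 : Fpot K B.1 q t = max (-K) (min K (dif B.1 q (posOf B.1 t))) := if_pos hG
      have e2 : Fpot K A.1 q t = max (-K) (min K (dif A.1 q (posOf A.1 t))) := if_pos T1
      rw [e1, e2, T2]
      simp [hC']
  · have e1 : Fpot K B.1 q t = -K := if_neg hG
    simp only [hG, false_and, if_false]
    omega

/-- distance of ranks -/
def rdist (r s : ℕ) : ℕ := (r - s) + (s - r)

noncomputable def nearCount (n r q : ℕ) (W : ℕ → Prop) : ℕ :=
  ((Finset.Icc 1 n).filter (fun s => W s ∧ q ≤ rdist r s ∧ rdist r s ≤ 8*q)).card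

lemma charge {m : ℕ} (A : Fin m → Bool) (n q r : ℕ) (W : ℕ → Prop) (hq : 1 ≤ q)
    (hn : n ≤ cnt A m) (hr1 : 2*q ≤ r) (hr2 : r + 8*q ≤ n + 1) :
    ((Finset.Ico q (2*q)).filter (fun d => Good A q (r-d) ∧ Crit A q (r-d) W)).card ≤
      3 * nearCount n r q W := by
  set S := (Finset.Icc 1 n).filter (fun s => W s ∧ q ≤ rdist r s ∧ rdist r s ≤ 8*q) with hS
  have key : ∀ d, q ≤ d → d < 2*q → 1 ≤ r-d ∧ r - d ≤ cnt A m ∧ posOf A (r-d) + 8*q ≤ m ∧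
      cnt A (posOf A (r-d)) + 1 = r - d := by
    intro d h1 h2
    obtain ⟨a, b, c⟩ := geo A q (r-d) (by omega) (by omega) hq
    exact ⟨by omega, by omega, a, c⟩
  have c1 : ((Finset.Ico q (2*q)).filter (fun d => Good A q (r-d) ∧ W (r-d))).card ≤ S.card := by
    apply Finset.card_le_card_of_injOn (fun d => r - d)
    · intro d hd
      simp only [Finset.coe_filter, Finset.mem_Ico, Set.mem_ofPred_eq, hS, Finset.mem_Icc] at hd ⊢
      refine ⟨by omega, hd.2.2, ?_⟩
      unfold rdist; omega
    · intro d hd d' hd' h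
      simp only [Finset.coe_filter, Finset.mem_Ico, Set.mem_ofPred_eq] at hd hd' h
      omega
  have c2 : ((Finset.Ico q (2*q)).filter (fun d => Good A q (r-d) ∧
      W (cnt A (posOf A (r-d) + 4*q)))).card ≤ S.card := by
    apply Finset.card_le_card_of_injOn (fun d => cnt A (posOf A (r-d) + 4*q))
    · intro d hd
      simp only [Finset.coe_filter, Finset.mem_Ico, Set.mem_ofPred_eq, hS, Finset.mem_Icc] at hd ⊢
      obtain ⟨k1, k2, k3, k4⟩ := key d hd.1.1 hd.1.2
      have := hd.2.1.2.2
      have c4 := cnt_add A (posOf A (r-d)) (4*q)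
      have l4 := blockCount_le A (posOf A (r-d)) (4*q)
      refine ⟨by omega, hd.2.2, ?_⟩
      unfold rdist; omega
    · intro d hd d' hd' h
      simp only [Finset.coe_filter, Finset.mem_Ico, Set.mem_ofPred_eq] at hd hd' h
      obtain ⟨k1, k2, k3, k4⟩ := key d hd.1.1 hd.1.2
      obtain ⟨k1', k2', k3', k4'⟩ := key d' hd'.1.1 hd'.1.2
      have x := posOf_cnt A _ (by omega) hd.2.1.1
      have x' := posOf_cnt A _ (by omega) hd'.2.1.1
      rw [show posOf A (r-d) + (4*q-1)+1 = posOf A (r-d) + 4*q by omega] at x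
      rw [show posOf A (r-d') + (4*q-1)+1 = posOf A (r-d') + 4*q by omega] at x'
      rw [h] at x
      have := posOf_inj A k1 k2 k1' k2' (by omega)
      omega
  have c3 : ((Finset.Ico q (2*q)).filter (fun d => Good A q (r-d) ∧
      W (cnt A (posOf A (r-d) + 8*q)))).card ≤ S.card := by
    apply Finset.card_le_card_of_injOn (fun d => cnt A (posOf A (r-d) + 8*q))
    · intro d hd
      simp only [Finset.coe_filter, Finset.mem_Ico, Set.mem_ofPred_eq, hS, Finset.mem_Icc] at hd ⊢
      obtain ⟨k1, k2, k3, k4⟩ := key d hd.1.1 hd.1.2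
      have := hd.2.1.2.2
      have c4 := cnt_add A (posOf A (r-d)) (4*q)
      have c48 : cnt A (posOf A (r-d)+4*q) ≤ cnt A (posOf A (r-d)+8*q) := cnt_mono _ (by omega)
      have c8 := cnt_add A (posOf A (r-d)) (8*q)
      have l8 := blockCount_le A (posOf A (r-d)) (8*q)
      refine ⟨by omega, hd.2.2, ?_⟩
      unfold rdist; omega
    · intro d hd d' hd' h
      simp only [Finset.coe_filter, Finset.mem_Ico, Set.mem_ofPred_eq] at hd hd' h
      obtain ⟨k1, k2, k3, k4⟩ := key d hd.1.1 hd.1.2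
      obtain ⟨k1', k2', k3', k4'⟩ := key d' hd'.1.1 hd'.1.2
      have x := posOf_cnt A _ (by omega) hd.2.1.2.1
      have x' := posOf_cnt A _ (by omega) hd'.2.1.2.1
      rw [show posOf A (r-d) + (8*q-1)+1 = posOf A (r-d) + 8*q by omega] at x
      rw [show posOf A (r-d') + (8*q-1)+1 = posOf A (r-d') + 8*q by omega] at x'
      rw [h] at x
      have := posOf_inj A k1 k2 k1' k2' (by omega)
      omega
  have hsub : (Finset.Ico q (2*q)).filter (fun d => Good A q (r-d) ∧ Crit A q (r-d) W) ⊆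
      ((Finset.Ico q (2*q)).filter (fun d => Good A q (r-d) ∧ W (r-d))) ∪
      (((Finset.Ico q (2*q)).filter (fun d => Good A q (r-d) ∧
      W (cnt A (posOf A (r-d) + 4*q)))) ∪ ((Finset.Ico q (2*q)).filter (fun d => Good A q (r-d) ∧
      W (cnt A (posOf A (r-d) + 8*q))))) := by
    intro d
    simp only [Finset.mem_filter, Finset.mem_union]
    unfold Crit
    tauto
  have := Finset.card_le_card hsub
  have u1 := Finset.card_union_le ((Finset.Ico q (2*q)).filter (fun d => Good A q (r-d) ∧ W (r-d)))
    (((Finset.Ico q (2*q)).filter (fun d => Good A q (r-d) ∧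
      W (cnt A (posOf A (r-d) + 4*q)))) ∪ ((Finset.Ico q (2*q)).filter (fun d => Good A q (r-d) ∧
      W (cnt A (posOf A (r-d) + 8*q)))))
  have u2 := Finset.card_union_le ((Finset.Ico q (2*q)).filter (fun d => Good A q (r-d) ∧
      W (cnt A (posOf A (r-d) + 4*q)))) ((Finset.Ico q (2*q)).filter (fun d => Good A q (r-d) ∧
      W (cnt A (posOf A (r-d) + 8*q))))
  have : nearCount n r q W = S.card := rfl
  omega

lemma scales (n r L : ℕ) (W : ℕ → Prop) :
    ∑ i ∈ Finset.range L, nearCount n r (2^i) W ≤ 4 * ((Finset.Icc 1 n).filter W).card := by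
  unfold nearCount
  have : ∀ i, ((Finset.Icc 1 n).filter (fun s => W s ∧ 2^i ≤ rdist r s ∧ rdist r s ≤ 8*2^i)).card
    = ∑ s ∈ (Finset.Icc 1 n).filter W, if (2^i ≤ rdist r s ∧ rdist r s ≤ 8*2^i) then 1 else 0 := by
    intro i
    rw [← Finset.filter_filter, Finset.card_filter]
  simp only [this]
  rw [Finset.sum_comm, mul_comm, ← smul_eq_mul]
  apply Finset.sum_le_card_nsmul
  intro s _
  rw [← Finset.card_filter]
  calc _ ≤ (Finset.Icc (Nat.log 2 (rdist r s) - 3) (Nat.log 2 (rdist r s))).card := by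
        apply Finset.card_le_card
        intro i hi
        simp only [Finset.mem_filter, Finset.mem_Icc] at hi ⊢
        have h0 : rdist r s ≠ 0 := by
          have := Nat.two_pow_pos i
          omega
        refine ⟨?_, Nat.le_log_of_pow_le (by norm_num) hi.2.1⟩
        have h8 : rdist r s ≤ 2^(i+3) := by rw [pow_add]; omega
        have := Nat.log_mono_right (b := 2) h8
        rw [Nat.log_pow (by norm_num)] at this
        omega
    _ ≤ 4 := by rw [Nat.card_Icc]; omega

lemma inj_count {m : ℕ} (A : Fin m → Bool) (R : Finset ℕ) (d : ℕ) (B : ℕ → Prop)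
    (hR : ∀ r ∈ R, 1 ≤ r - d ∧ r - d ≤ cnt A m) :
    (R.filter (fun r => B (posOf A (r-d)))).card ≤ ((Finset.range m).filter B).card := by
  apply Finset.card_le_card_of_injOn (fun r => posOf A (r-d))
  · intro r hr
    simp only [Finset.coe_filter, Set.mem_ofPred_eq, Finset.mem_range] at hr ⊢
    obtain ⟨h1, h2⟩ := hR r hr.1
    exact ⟨(posOf_spec A _ h1 h2).1, hr.2⟩
  · intro r hr r' hr' h
    simp only [Finset.coe_filter, Set.mem_ofPred_eq] at hr hr' h
    obtain ⟨h1, h2⟩ := hR r hr.1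
    obtain ⟨h1', h2'⟩ := hR r' hr'.1
    have := posOf_inj A h1 h2 h1' h2' h
    omega

/-- Markov on finite sums -/
lemma markov (S : Finset ℕ) (B : ℕ → Prop) (f : ℕ → ℝ) (a : ℝ) (hf : ∀ p ∈ S, 0 ≤ f p)
    (hB : ∀ p ∈ S, B p → a ≤ f p) : a * ((S.filter B).card : ℝ) ≤ ∑ p ∈ S, f p := by
  calc a * ((S.filter B).card : ℝ) = ∑ p ∈ S.filter B, a := by simp [mul_comm]
    _ ≤ ∑ p ∈ S.filter B, f p := by
        apply Finset.sum_le_sum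
        intro p hp
        rw [Finset.mem_filter] at hp
        exact hB p hp.1 hp.2
    _ ≤ _ := Finset.sum_le_sum_of_subset_of_nonneg (Finset.filter_subset _ _)
        (fun p hp _ => hf p hp)

lemma sum_free {m : ℕ} (A : Fin m → Bool) (j : ℕ) :
    ∑ p ∈ Finset.range m, ((j : ℝ) - blockCount m A p j) = j * ((m:ℝ) - cnt A m) := by
  have := sum_blockCount A j
  have h2 : ∑ p ∈ Finset.range m, (blockCount m A p j : ℝ) = j * cnt A m := by exact_mod_cast this
  rw [Finset.sum_sub_distrib, h2]
  simp; ring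

/-- Main averaging estimate for a fixed configuration. -/
lemma avg_point {m n : ℕ} (A : Config m n) (c : ℝ) (R : Finset ℕ) (d q K : ℕ) (hq : 1 ≤ q)
    (hK : 1 ≤ K) (hm : 0 < m) (hc : 0 < c) (hnm : n < m)
    (hR : ∀ r ∈ R, 1 ≤ r - d ∧ r - d ≤ n) :
    (R.card : ℝ) - 6 * ((m:ℝ) - n) - m / c - 4 * q * m / K *
        DeltaAvg c (1 - (n:ℝ)/m) m A.1 (8*q) ≤
      ((R.filter (fun r => Good A.1 q (r-d) ∧ |dif A.1 q (posOf A.1 (r-d))| < (K:ℤ))).card : ℝ) := by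
  have hA := cnt_config A
  have hmR : (0:ℝ) < m := by exact_mod_cast hm
  have hnmR : (n:ℝ) < m := by exact_mod_cast hnm
  have hKR : (1:ℝ) ≤ K := by exact_mod_cast hK
  have hqR : (1:ℝ) ≤ q := by exact_mod_cast hq
  set ε : ℝ := 1 - (n:ℝ)/m with hε
  have hεm : ε * m = m - n := by rw [hε]; field_simp
  have hεp : 0 < ε := by
    by_contra h
    push Not at h
    nlinarith
  obtain ⟨B1, hB1⟩ : ∃ B : ℕ → Prop, ∀ p, B p ↔ (¬ cyc m A.1 (p + (4*q-1)) = true) := ⟨_, fun _ => Iff.rfl⟩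
  obtain ⟨B2, hB2⟩ : ∃ B : ℕ → Prop, ∀ p, B p ↔ (¬ cyc m A.1 (p + (8*q-1)) = true) := ⟨_, fun _ => Iff.rfl⟩
  obtain ⟨B3, hB3⟩ : ∃ B : ℕ → Prop, ∀ p, B p ↔ (blockCount m A.1 p (4*q) < 3*q) := ⟨_, fun _ => Iff.rfl⟩
  obtain ⟨B4, hB4⟩ : ∃ B : ℕ → Prop, ∀ p, B p ↔ (¬ IsLive c ε m A.1 p (8*q)) := ⟨_, fun _ => Iff.rfl⟩
  obtain ⟨B5, hB5⟩ : ∃ B : ℕ → Prop, ∀ p, B p ↔ (IsLive c ε m A.1 p (8*q) ∧ (K:ℤ) ≤ |dif A.1 q p|) := ⟨_, fun _ => Iff.rfl⟩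
  have hR' : ∀ r ∈ R, 1 ≤ r - d ∧ r - d ≤ cnt A.1 m := by rw [hA]; exact hR
  have n1 : ∀ t, (((Finset.range m).filter (fun p => ¬ cyc m A.1 (p + t) = true)).card : ℝ) = m - n := by
    intro t
    have e1 := card_shift A.1 t
    have e2 := Finset.card_filter_add_card_filter_not (s := Finset.range m)
      (fun p => cyc m A.1 (p + t) = true)
    rw [e1, hA, Finset.card_range] at e2
    have : (n:ℝ) + (((Finset.range m).filter (fun p => ¬ cyc m A.1 (p + t) = true)).card : ℝ) = m := by
      exact_mod_cast e2
    linarith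
  have b1 := n1 (4*q-1)
  have b2 := n1 (8*q-1)
  have b3 : (((Finset.range m).filter B3).card : ℝ) ≤ 4 * (m - n) := by
    have := markov (Finset.range m) B3 (fun p => ((4*q:ℕ):ℝ) - blockCount m A.1 p (4*q)) q
      (fun p _ => by
        have := blockCount_le A.1 p (4*q)
        have : (blockCount m A.1 p (4*q) : ℝ) ≤ ((4*q:ℕ):ℝ) := by exact_mod_cast this
        linarith)
      (fun p _ hp => by
        have hp : blockCount m A.1 p (4*q) < 3*q := (hB3 p).1 hp
        have : (blockCount m A.1 p (4*q) : ℝ) ≤ 3 * q := by exact_mod_cast hp.le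
        push_cast; linarith)
    rw [sum_free, hA] at this
    push_cast at this
    have : (q:ℝ) * (((Finset.range m).filter B3).card : ℝ) ≤ q * (4 * (m - n)) := by linarith
    exact le_of_mul_le_mul_left this (by linarith)
  have b4 : (((Finset.range m).filter B4).card : ℝ) ≤ m / c := by
    have := markov (Finset.range m) B4 (fun p => ((8*q:ℕ):ℝ) - blockCount m A.1 p (8*q))
      (c * ε * (8*q))
      (fun p _ => by
        have := blockCount_le A.1 p (8*q)
        have : (blockCount m A.1 p (8*q) : ℝ) ≤ ((8*q:ℕ):ℝ) := by exact_mod_cast this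
        linarith)
      (fun p _ hp => by
        have hp : ¬ (1 - c * ε ≤ (blockCount m A.1 p (8*q) : ℝ) / ((8*q:ℕ):ℝ)) := (hB4 p).1 hp
        push Not at hp
        rw [div_lt_iff₀ (by push_cast; linarith)] at hp
        push_cast at hp ⊢; linarith)
    rw [sum_free, hA, ← hεm] at this
    push_cast at this
    rw [le_div_iff₀ hc]
    have h8 : (0:ℝ) < ε * (8*q) := by positivity
    refine le_of_mul_le_mul_left ?_ h8
    linarith
  have b5 : (((Finset.range m).filter B5).card : ℝ) ≤ 4 * q * m / K * DeltaAvg c ε m A.1 (8*q) := by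
    have := markov (Finset.range m) B5 (fun p => adjImbalance c ε m A.1 p (8*q))
      ((K:ℝ) / (4*q))
      (fun p _ => by
        unfold adjImbalance imbalance; split_ifs <;> positivity)
      (fun p _ hp => by
        have hp : IsLive c ε m A.1 p (8*q) ∧ (K:ℤ) ≤ |dif A.1 q p| := (hB5 p).1 hp
        show _ ≤ adjImbalance c ε m A.1 p (8*q)
        unfold adjImbalance
        rw [if_pos hp.1]
        unfold imbalance blockDensity
        rw [show 8*q/2 = 4*q by omega, ← sub_div, abs_div]
        have h4 : |((4*q:ℕ):ℝ)| = 4*q := by push_cast; rw [abs_of_nonneg (by positivity)]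
        rw [h4]
        have h2 : ((K:ℤ):ℝ) ≤ ((|dif A.1 q p| : ℤ):ℝ) := by exact_mod_cast hp.2
        unfold dif at h2
        push_cast at h2
        gcongr)
    unfold DeltaAvg
    have h4 : (0:ℝ) < K / (4*q) := by positivity
    refine le_of_mul_le_mul_left (this.trans (le_of_eq ?_)) h4
    field_simp
  have i1 : ((R.filter (fun r => B1 (posOf A.1 (r-d)))).card : ℝ) ≤ (((Finset.range m).filter B1).card : ℝ) :=
    Nat.cast_le.mpr (inj_count A.1 R d B1 hR')
  have i2 : ((R.filter (fun r => B2 (posOf A.1 (r-d)))).card : ℝ) ≤ (((Finset.range m).filter B2).card : ℝ) :=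
    Nat.cast_le.mpr (inj_count A.1 R d B2 hR')
  have i3 : ((R.filter (fun r => B3 (posOf A.1 (r-d)))).card : ℝ) ≤ (((Finset.range m).filter B3).card : ℝ) :=
    Nat.cast_le.mpr (inj_count A.1 R d B3 hR')
  have i4 : ((R.filter (fun r => B4 (posOf A.1 (r-d)))).card : ℝ) ≤ (((Finset.range m).filter B4).card : ℝ) :=
    Nat.cast_le.mpr (inj_count A.1 R d B4 hR')
  have i5 : ((R.filter (fun r => B5 (posOf A.1 (r-d)))).card : ℝ) ≤ (((Finset.range m).filter B5).card : ℝ) :=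
    Nat.cast_le.mpr (inj_count A.1 R d B5 hR')
  have cover : (R.card : ℝ) ≤
     ((R.filter (fun r => Good A.1 q (r-d) ∧ |dif A.1 q (posOf A.1 (r-d))| < (K:ℤ))).card : ℝ) +
     (R.filter (fun r => B1 (posOf A.1 (r-d)))).card + (R.filter (fun r => B2 (posOf A.1 (r-d)))).card
     + (R.filter (fun r => B3 (posOf A.1 (r-d)))).card + (R.filter (fun r => B4 (posOf A.1 (r-d)))).card
     + (R.filter (fun r => B5 (posOf A.1 (r-d)))).card := by
    simp only [Finset.card_filter]
    norm_cast
    rw [Finset.card_eq_sum_ones]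
    simp only [← Finset.sum_add_distrib]
    apply Finset.sum_le_sum
    intro r _
    by_cases g1 : B1 (posOf A.1 (r-d))
    · simp only [g1, if_true]; omega
    by_cases g2 : B2 (posOf A.1 (r-d))
    · simp only [g2, if_true]; omega
    by_cases g3 : B3 (posOf A.1 (r-d))
    · simp only [g3, if_true]; omega
    by_cases g4 : B4 (posOf A.1 (r-d))
    · simp only [g4, if_true]; omega
    by_cases g5 : B5 (posOf A.1 (r-d))
    · simp only [g5, if_true]; omega
    have : Good A.1 q (r-d) ∧ |dif A.1 q (posOf A.1 (r-d))| < (K:ℤ) := by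
      simp only [hB1, hB2, hB3, hB4, hB5, not_not, not_lt, not_and, not_le] at g1 g2 g3 g4 g5
      exact ⟨⟨g1, g2, g3⟩, g5 g4⟩
    rw [if_pos this]
    omega
  have b1' : (((Finset.range m).filter B1).card : ℝ) = m - n := by
    rw [← b1]; congr 2; ext p; simp only [Finset.mem_filter, hB1]
  have b2' : (((Finset.range m).filter B2).card : ℝ) = m - n := by
    rw [← b2]; congr 2; ext p; simp only [Finset.mem_filter, hB2]
  linarith

lemma pexp_map {α β : Type*} [Fintype α] [Fintype β] (p : PMF α) (f : α → β) (g : β → ℝ) :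
    pexp (p.map f) g = pexp p (fun a => g (f a)) := by
  unfold pexp
  have h : ∀ b, ((p.map f) b).toReal = ∑ a, if b = f a then (p a).toReal else 0 := by
    intro b
    rw [PMF.map_apply, tsum_fintype, ENNReal.toReal_sum]
    · apply Finset.sum_congr rfl
      intro a _
      split_ifs <;> simp
    · intro a _
      split_ifs
      · exact p.apply_ne_top a
      · simp
  simp only [h, Finset.sum_mul]
  rw [Finset.sum_comm]
  apply Finset.sum_congr rfl
  intro a _
  rw [Finset.sum_eq_single (f a)]
  · simp
  · intro b _ hb; simp [hb]
  · simp

lemma pexp_tower {α β : Type*} [Fintype α] [Fintype β] (p : PMF α) (f : α → β)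
    (C : β → PMF α) (hC : ∀ b a, (p.map f) b * C b a = if f a = b then p a else 0)
    (g : α → ℝ) :
    pexp (p.map f) (fun b => pexp (C b) g) = pexp p g := by
  unfold pexp
  simp only [Finset.mul_sum]
  rw [Finset.sum_comm]
  apply Finset.sum_congr rfl
  intro a _
  have h : ∀ b, ((p.map f) b).toReal * (((C b) a).toReal * g a) =
      if f a = b then (p a).toReal * g a else 0 := by
    intro b
    rw [← mul_assoc, ← ENNReal.toReal_mul, hC]
    split_ifs <;> simp
  simp only [h]
  simp

lemma filter_cond {α β : Type*} [Fintype α] (p : PMF α) (f : α → β) (b : β)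
    (h : ∃ q ∈ {q : α | f q = b}, q ∈ p.support) (a : α) :
    (p.map f) b * (p.filter {q | f q = b} h) a = if f a = b then p a else 0 := by
  rw [PMF.filter_apply]
  have e : (p.map f) b = ∑' a', Set.indicator {q | f q = b} p a' := by
    rw [PMF.map_apply]
    apply tsum_congr
    intro a'
    simp only [Set.indicator_apply, Set.mem_ofPred_eq, eq_comm]
  rw [e]
  set S := ∑' a', Set.indicator {q | f q = b} p a' with hS
  have hS0 : S ≠ 0 := by
    rw [← e]
    obtain ⟨q, hq, hq2⟩ := h
    have : b ∈ (p.map f).support := by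
      rw [PMF.support_map]; exact ⟨q, hq2, hq⟩
    exact this
  have hST : S ≠ ⊤ := p.tsum_coe_indicator_ne_top _
  rw [mul_left_comm, ENNReal.mul_inv_cancel hS0 hST, mul_one]
  simp [Set.indicator_apply]

lemma null_cond {α β : Type*} [Fintype α] (p : PMF α) (f : α → β) (b : β)
    (h : ¬ ∃ q ∈ {q : α | f q = b}, q ∈ p.support) (a : α) (x : ENNReal) :
    (p.map f) b * x = if f a = b then p a else 0 := by
  have h0 : ∀ q, f q = b → p q = 0 := by
    intro q hq
    by_contra hne
    exact h ⟨q, hq, hne⟩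
  have : (p.map f) b = 0 := by
    by_contra hne
    have : b ∈ (p.map f).support := hne
    rw [PMF.support_map] at this
    obtain ⟨q, hq, hqb⟩ := this
    exact hq (h0 q hqb)
  rw [this, zero_mul]
  split_ifs with hh
  · exact (h0 a hh).symm
  · rfl

lemma condFst_tower {m n : ℕ} (p : PMF (Config m n × Config m (n + 1)))
    (g : Config m n × Config m (n + 1) → ℝ) :
    pexp (p.map Prod.fst) (fun A => pexp (condFst p A) g) = pexp p g := by
  apply pexp_tower
  intro b a
  unfold condFst
  split_ifs with h1 h2 h2
  · rw [filter_cond p Prod.fst b h1 a, if_pos h2]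
  · rw [filter_cond p Prod.fst b h1 a, if_neg h2]
  · rw [null_cond p Prod.fst b h1 a, if_pos h2]
  · rw [null_cond p Prod.fst b h1 a, if_neg h2]

lemma condSnd_tower {m n : ℕ} (p : PMF (Config m n × Config m (n + 1)))
    (g : Config m n × Config m (n + 1) → ℝ) :
    pexp (p.map Prod.snd) (fun A => pexp (condSnd p A) g) = pexp p g := by
  apply pexp_tower
  intro b a
  unfold condSnd
  split_ifs with h1 h2 h2
  · rw [filter_cond p Prod.snd b h1 a, if_pos h2]
  · rw [filter_cond p Prod.snd b h1 a, if_neg h2]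
  · rw [null_cond p Prod.snd b h1 a, if_pos h2]
  · rw [null_cond p Prod.snd b h1 a, if_neg h2]

lemma pexp_add {α : Type*} [Fintype α] (p : PMF α) (f g : α → ℝ) :
    pexp p (fun a => f a + g a) = pexp p f + pexp p g := by
  unfold pexp; simp [mul_add, Finset.sum_add_distrib]

lemma pexp_sub {α : Type*} [Fintype α] (p : PMF α) (f g : α → ℝ) :
    pexp p (fun a => f a - g a) = pexp p f - pexp p g := by
  unfold pexp; simp [mul_sub, Finset.sum_sub_distrib]

lemma pexp_mul {α : Type*} [Fintype α] (p : PMF α) (x : ℝ) (f : α → ℝ) :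
    pexp p (fun a => x * f a) = x * pexp p f := by
  unfold pexp; rw [Finset.mul_sum]; apply Finset.sum_congr rfl; intros; ring

lemma pexp_const {α : Type*} [Fintype α] (p : PMF α) (x : ℝ) :
    pexp p (fun _ => x) = x := by
  unfold pexp
  rw [← Finset.sum_mul, ← ENNReal.toReal_sum (fun a _ => p.apply_ne_top a), ← tsum_fintype (L := .unconditional _),
    p.tsum_coe]
  simp

lemma pexp_sum {α ι : Type*} [Fintype α] (p : PMF α) (S : Finset ι) (f : ι → α → ℝ) :
    pexp p (fun a => ∑ i ∈ S, f i a) = ∑ i ∈ S, pexp p (f i) := by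
  unfold pexp
  simp only [Finset.mul_sum]
  rw [Finset.sum_comm]

lemma pexp_mono {α : Type*} [Fintype α] (p : PMF α) (f g : α → ℝ) (h : ∀ a, f a ≤ g a) :
    pexp p f ≤ pexp p g := by
  unfold pexp
  exact Finset.sum_le_sum (fun a _ => mul_le_mul_of_nonneg_left (h a) ENNReal.toReal_nonneg)

lemma expPairCost_eq {m n : ℕ} (Mo : HIModel m n) (r : ℕ) (h1 : 1 ≤ r) (h2 : r ≤ n + 1) :
    expPairCost Mo r = pexp (Mo.ins r) (fun q => (insCost m n r q.1 q.2 : ℝ)) +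
      pexp Mo.del (fun q => (delCost m n q.1 q.2 : ℝ)) := by
  unfold expPairCost
  rw [← Mo.ins_fst r h1 h2, condFst_tower, pexp_add]
  congr 1
  rw [← condSnd_tower Mo.del, Mo.del_snd, ← Mo.ins_snd r h1 h2, pexp_map]

/-- Critical indicator expectations. -/
noncomputable def pIns {m n : ℕ} (Mo : HIModel m n) (q r d : ℕ) : ℝ :=
  pexp (Mo.ins r) (fun x => if Good x.1.1 q (r-d) ∧ Crit x.1.1 q (r-d) (Wins r x.1.1 x.2.1) then (1:ℝ) else 0)
noncomputable def pDel {m n : ℕ} (Mo : HIModel m n) (q r d : ℕ) : ℝ :=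
  pexp Mo.del (fun x => if Good x.2.1 q (r-d) ∧ Crit x.2.1 q (r-d) (Wdel x.1.1 x.2.1) then (1:ℝ) else 0)

lemma one_step {m n : ℕ} (Mo : HIModel m n) (q r d K : ℕ) (hq : 1 ≤ q)
    (hr1 : 2*q ≤ r) (hr2 : r + 8*q ≤ n + 1) (hd : q ≤ d) (hd2 : d < 2*q) :
    pexp Mo.C0 (fun A => if Good A.1 q (r-d) ∧ |dif A.1 q (posOf A.1 (r-d))| < (K:ℤ)
      then (1:ℝ) else 0) ≤ (2*K+1) * (pIns Mo q r d + pDel Mo q r d) := by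
  have hi1 := Mo.ins_fst r (by omega) (by omega)
  have hi2 := Mo.ins_snd r (by omega) (by omega)
  have a := pexp_mono (Mo.ins r) (fun x => if Good x.1.1 q (r-d) ∧
        |dif x.1.1 q (posOf x.1.1 (r-d))| < (K:ℤ) then (1:ℝ) else 0)
      (fun x => ((Fpot K x.2.1 q (r-d) : ℝ) - (Fpot K x.1.1 q (r-d) : ℝ)) + (2*K+1) *
        (if Good x.1.1 q (r-d) ∧ Crit x.1.1 q (r-d) (Wins r x.1.1 x.2.1) then (1:ℝ) else 0))
      (fun x => by
        have := ins_point x.1 x.2 q (r-d) d r K (by omega) hq (by omega) (by omega) (by omega) hd hd2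
        have h : (((if Good x.1.1 q (r-d) ∧ |dif x.1.1 q (posOf x.1.1 (r-d))| < (K:ℤ) then (1:ℤ) else 0 : ℤ)) : ℝ) ≤ _ :=
          Int.cast_le.mpr this
        push_cast at h
        exact h)
  have b := pexp_mono Mo.del (fun x => 0)
      (fun x => ((Fpot K x.1.1 q (r-d) : ℝ) - (Fpot K x.2.1 q (r-d) : ℝ)) + (2*K+1) *
        (if Good x.2.1 q (r-d) ∧ Crit x.2.1 q (r-d) (Wdel x.1.1 x.2.1) then (1:ℝ) else 0))
      (fun x => by
        have := del_point x.1 x.2 q (r-d) K (by omega) hq (by omega) (by omega)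
        have h : ((0 : ℤ) : ℝ) ≤ _ := Int.cast_le.mpr this
        push_cast at h
        exact h)
  rw [pexp_const, pexp_add, pexp_sub, pexp_mul] at b
  rw [pexp_add, pexp_sub, pexp_mul] at a
  have e1 := pexp_map (Mo.ins r) Prod.fst (fun A => if Good A.1 q (r-d) ∧ |dif A.1 q (posOf A.1 (r-d))| < (K:ℤ)
      then (1:ℝ) else 0)
  have e2 := pexp_map (Mo.ins r) Prod.fst (fun A => (Fpot K A.1 q (r-d) : ℝ))
  have e3 := pexp_map (Mo.ins r) Prod.snd (fun A => (Fpot K A.1 q (r-d) : ℝ))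
  have e4 := pexp_map Mo.del Prod.fst (fun A => (Fpot K A.1 q (r-d) : ℝ))
  have e5 := pexp_map Mo.del Prod.snd (fun A => (Fpot K A.1 q (r-d) : ℝ))
  rw [hi1] at e1 e2
  rw [hi2] at e3
  rw [Mo.del_fst] at e4
  rw [Mo.del_snd] at e5
  unfold pIns pDel
  rw [e1]
  linarith

lemma sum_crit_le {m n : ℕ} (Mo : HIModel m n) (r L : ℕ)
    (h : ∀ i < L, 2*2^i ≤ r ∧ r + 8*2^i ≤ n+1) (h1 : 1 ≤ r) (h2 : r ≤ n + 1) :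
    ∑ i ∈ Finset.range L, ∑ d ∈ Finset.Ico (2^i) (2*2^i), (pIns Mo (2^i) r d + pDel Mo (2^i) r d)
      ≤ 12 * expPairCost Mo r := by
  rw [expPairCost_eq Mo r h1 h2]
  simp only [Finset.sum_add_distrib]
  unfold pIns pDel
  simp only [← pexp_sum]
  rw [mul_add, ← pexp_mul, ← pexp_mul]
  apply add_le_add
  · apply pexp_mono
    intro x
    have : ∑ i ∈ Finset.range L, ((Finset.Ico (2^i) (2*2^i)).filter (fun d =>
        Good x.1.1 (2^i) (r-d) ∧ Crit x.1.1 (2^i) (r-d) (Wins r x.1.1 x.2.1))).card ≤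
        12 * insCost m n r x.1 x.2 := by
      calc _ ≤ ∑ i ∈ Finset.range L, 3 * nearCount n r (2^i) (Wins r x.1.1 x.2.1) := by
            apply Finset.sum_le_sum
            intro i hi
            obtain ⟨g1, g2⟩ := h i (Finset.mem_range.1 hi)
            exact charge x.1.1 n (2^i) r _ Nat.one_le_two_pow (cnt_config x.1).ge g1 g2
        _ ≤ 3 * (4 * ((Finset.Icc 1 n).filter (Wins r x.1.1 x.2.1)).card) := by
            rw [← Finset.mul_sum]
            exact Nat.mul_le_mul_left _ (scales _ _ _ _)
        _ ≤ _ := by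
            have : ((Finset.Icc 1 n).filter (Wins r x.1.1 x.2.1)).card =
              ((Finset.Icc 1 n).filter
                (fun s => posOf x.1.1 s ≠ posOf x.2.1 (insShift r s))).card := by
              congr 1; ext s; simp only [Finset.mem_filter, Wins]
            unfold insCost
            omega
    have h' : ((∑ i ∈ Finset.range L, ((Finset.Ico (2^i) (2*2^i)).filter (fun d =>
        Good x.1.1 (2^i) (r-d) ∧ Crit x.1.1 (2^i) (r-d) (Wins r x.1.1 x.2.1))).card : ℕ) : ℝ) ≤
        ((12 * insCost m n r x.1 x.2 : ℕ) : ℝ) := Nat.cast_le.mpr this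
    simp only [Finset.card_filter] at h'
    push_cast at h'
    exact h'
  · apply pexp_mono
    intro x
    have : ∑ i ∈ Finset.range L, ((Finset.Ico (2^i) (2*2^i)).filter (fun d =>
        Good x.2.1 (2^i) (r-d) ∧ Crit x.2.1 (2^i) (r-d) (Wdel x.1.1 x.2.1))).card ≤
        12 * delCost m n x.1 x.2 := by
      calc _ ≤ ∑ i ∈ Finset.range L, 3 * nearCount n r (2^i) (Wdel x.1.1 x.2.1) := by
            apply Finset.sum_le_sum
            intro i hi
            obtain ⟨g1, g2⟩ := h i (Finset.mem_range.1 hi)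
            exact charge x.2.1 n (2^i) r _ Nat.one_le_two_pow (by rw [cnt_config]; omega) g1 g2
        _ ≤ 3 * (4 * ((Finset.Icc 1 n).filter (Wdel x.1.1 x.2.1)).card) := by
            rw [← Finset.mul_sum]
            exact Nat.mul_le_mul_left _ (scales _ _ _ _)
        _ ≤ _ := by
            have : ((Finset.Icc 1 n).filter (Wdel x.1.1 x.2.1)).card =
              ((Finset.Icc 1 n).filter
                (fun s => posOf x.2.1 s ≠ posOf x.1.1 s)).card := by
              congr 1; ext s; simp only [Finset.mem_filter, Wdel]
            unfold delCost
            omega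
    have h' : ((∑ i ∈ Finset.range L, ((Finset.Ico (2^i) (2*2^i)).filter (fun d =>
        Good x.2.1 (2^i) (r-d) ∧ Crit x.2.1 (2^i) (r-d) (Wdel x.1.1 x.2.1))).card : ℕ) : ℝ) ≤
        ((12 * delCost m n x.1 x.2 : ℕ) : ℝ) := Nat.cast_le.mpr this
    simp only [Finset.card_filter] at h'
    push_cast at h'
    exact h'

lemma DeltaExp_nonneg (c : ℝ) {m n : ℕ} (Mo : HIModel m n) (j : ℕ) : 0 ≤ DeltaExp c Mo j := by
  unfold DeltaExp pexp
  apply Finset.sum_nonneg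
  intro A _
  apply mul_nonneg ENNReal.toReal_nonneg
  unfold DeltaAvg
  apply div_nonneg _ (by positivity)
  apply Finset.sum_nonneg
  intro p _
  unfold adjImbalance imbalance
  split_ifs <;> positivity

/-- Lower bound at a single scale. -/
lemma scale_bound {m n : ℕ} (Mo : HIModel m n) (c : ℝ) (R : Finset ℕ) (q : ℕ) (hq : 1 ≤ q)
    (hm : 0 < m) (hc : 1000 ≤ c) (hnm : n < m) (hε : (m:ℝ) - n ≤ m / c)
    (hR : ∀ r ∈ R, 2*q ≤ r ∧ r + 8*q ≤ n + 1) (hcard : (m:ℝ) / 5 ≤ R.card) :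
    (R.card : ℝ) * (1 / (DeltaExp c Mo (8*q) + 1 / ((8*q : ℕ):ℝ))) ≤
      368 * ∑ r ∈ R, ∑ d ∈ Finset.Ico q (2*q), (pIns Mo q r d + pDel Mo q r d) := by
  have hΔ := DeltaExp_nonneg c Mo (8*q)
  set Δ := DeltaExp c Mo (8*q) with hΔd
  have hmR : (0:ℝ) < m := by exact_mod_cast hm
  have hqR : (1:ℝ) ≤ q := by exact_mod_cast hq
  obtain ⟨K, hK1, hK2⟩ : ∃ K : ℕ, 10 * (8*q*Δ+1) ≤ (K:ℝ) ∧ (K:ℝ) ≤ 10 * (8*q*Δ+1) + 1 :=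
    ⟨⌈10 * (8*q*Δ+1)⌉₊, Nat.le_ceil _, (Nat.ceil_lt_add_one (by positivity)).le⟩
  have hqΔ : 0 ≤ q * Δ := by positivity
  have hKp : (1:ℝ) ≤ K := by linarith
  have hK0 : 1 ≤ K := by exact_mod_cast hKp
  have each : ∀ d ∈ Finset.Ico q (2*q), (R.card : ℝ) / 2 ≤
      (2*K+1) * ∑ r ∈ R, (pIns Mo q r d + pDel Mo q r d) := by
    intro d hd
    rw [Finset.mem_Ico] at hd
    have a := pexp_mono Mo.C0 _ _ (fun A => avg_point A c R d q K hq hK0 hm (by linarith) hnm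
      (fun r hr => by have := hR r hr; omega))
    rw [pexp_sub, pexp_const, pexp_mul] at a
    change _ - _ * Δ ≤ _ at a
    have b : pexp Mo.C0 (fun A => ((R.filter (fun r => Good A.1 q (r-d) ∧
        |dif A.1 q (posOf A.1 (r-d))| < (K:ℤ))).card : ℝ)) ≤
        (2*K+1) * ∑ r ∈ R, (pIns Mo q r d + pDel Mo q r d) := by
      simp only [Finset.card_filter]
      push_cast
      rw [pexp_sum, Finset.mul_sum]
      apply Finset.sum_le_sum
      intro r hr
      have := hR r hr
      exact one_step Mo q r d K hq this.1 this.2 hd.1 hd.2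
    have h1 : (m:ℝ) / c ≤ m / 1000 := by gcongr
    have h2 : 4 * q * m / K * Δ ≤ m / 20 := by
      rw [div_mul_eq_mul_div, div_le_div_iff₀ (by linarith) (by norm_num)]
      nlinarith
    linarith
  have tot := Finset.sum_le_sum each
  rw [Finset.sum_const, Nat.card_Ico, ← Finset.mul_sum, Finset.sum_comm] at tot
  set S := ∑ r ∈ R, ∑ d ∈ Finset.Ico q (2*q), (pIns Mo q r d + pDel Mo q r d) with hS
  rw [show 2*q - q = q by omega, nsmul_eq_mul] at tot
  have hD : 0 < Δ + 1 / ((8*q : ℕ):ℝ) := by positivity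
  rw [mul_one_div, div_le_iff₀ hD]
  have hS0 : 0 ≤ S := by
    have : (0:ℝ) ≤ (2*K+1) * S := le_trans (by positivity) tot
    exact nonneg_of_mul_nonneg_right this (by positivity)
  have h23 : (2*K+1 : ℝ) ≤ 23 * (8*q*Δ+1) := by linarith
  have e : 8*q*Δ+1 = 8 * q * (Δ + 1 / ((8*q : ℕ):ℝ)) := by
    push_cast; field_simp
  rw [e] at h23
  have := mul_le_mul_of_nonneg_right h23 hS0
  have hq0 : (0:ℝ) < q := by linarith
  refine le_of_mul_le_mul_left ?_ hq0
  nlinarith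

lemma cost_ge_one {m n : ℕ} (Mo : HIModel m n) (r : ℕ) (h1 : 1 ≤ r) (h2 : r ≤ n + 1) :
    1 ≤ expPairCost Mo r := by
  rw [expPairCost_eq Mo r h1 h2]
  have a := pexp_mono (Mo.ins r) (fun _ => (1:ℝ)) (fun q => (insCost m n r q.1 q.2 : ℝ))
    (fun x => by unfold insCost; push_cast; linarith [Nat.cast_nonneg (α := ℝ) ((Finset.Icc 1 n).filter
        (fun s => posOf x.1.1 s ≠ posOf x.2.1 (insShift r s))).card])
  have b := pexp_mono Mo.del (fun _ => (0:ℝ)) (fun q => (delCost m n q.1 q.2 : ℝ))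
    (fun x => by positivity)
  rw [pexp_const] at a b
  linarith

lemma Jset_sum (m : ℕ) (f : ℕ → ℝ) (hf : ∀ j, 0 ≤ f j) :
    ∑ j ∈ Jset m, f j ≤ f 2 + f 4 + ∑ i ∈ Finset.range (Nat.log 2 m - 4), f (8*2^i) := by
  have hsub : Jset m ⊆ {2, 4} ∪ (Finset.range (Nat.log 2 m - 4)).image (fun i => 8*2^i) := by
    intro j hj
    unfold Jset at hj
    simp only [Finset.mem_image, Finset.mem_Icc] at hj
    obtain ⟨i, hi, rfl⟩ := hj
    simp only [Finset.mem_union, Finset.mem_insert, Finset.mem_singleton, Finset.mem_image,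
      Finset.mem_range]
    rcases Nat.lt_or_ge i 3 with h | h
    · left
      interval_cases i <;> simp at *
    · right
      obtain ⟨k, rfl⟩ := Nat.exists_eq_add_of_le h
      exact ⟨k, by omega, by rw [pow_add]; norm_num⟩
  refine (Finset.sum_le_sum_of_subset_of_nonneg hsub (fun j _ _ => hf j)).trans ?_
  have h := Finset.sum_union_inter (s₁ := ({2,4} : Finset ℕ))
    (s₂ := (Finset.range (Nat.log 2 m - 4)).image (fun i => 8*2^i)) (f := f)
  have h0 := Finset.sum_nonneg (s := ({2,4} : Finset ℕ) ∩
    (Finset.range (Nat.log 2 m - 4)).image (fun i => 8*2^i)) (f := f) (fun j _ => hf j)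
  rw [Finset.sum_image (f := f) (s := Finset.range (Nat.log 2 m - 4)) (g := fun i => 8*2^i)
    (fun a _ b _ hab => Nat.pow_right_injective (le_refl 2) (by simpa using hab)),
    Finset.sum_pair (by norm_num)] at h
  linarith

theorem statement16 :
    ∃ c₀ : ℝ, 10 ≤ c₀ ∧ ∃ κ : ℝ, 0 < κ ∧
      ∀ c : ℝ, c₀ ≤ c → ∃ M : ℕ, ∀ m : ℕ, M ≤ m →
      ∀ n : ℕ, n ≤ m →
      ((m : ℝ) ^ (-(1 : ℝ) / 3) ≤ 1 - (n : ℝ) / m) → (1 - (n : ℝ) / m ≤ 1 / c) →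
      ∀ Mo : HIModel m n,
      κ * ∑ j ∈ Jset m, 1 / (DeltaExp c Mo j + 1 / j) ≤
        (1 / ((Finset.Icc ((n + 3) / 4) (n / 2)).card : ℝ)) *
          ∑ r ∈ Finset.Icc ((n + 3) / 4) (n / 2), expPairCost Mo r := by
  refine ⟨1000, by norm_num, 1/5000, by norm_num, ?_⟩
  intro c hc
  refine ⟨1000, ?_⟩
  intro m hm n hnm' hε1 hε2 Mo
  have hmR : (1000:ℝ) ≤ m := by exact_mod_cast hm
  have hm0 : (0:ℝ) < m := by linarith
  have hpos : (0:ℝ) < 1 - (n:ℝ)/m := lt_of_lt_of_le (Real.rpow_pos_of_pos hm0 _) hε1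
  have hnmR : (n:ℝ) < m := by
    have : (n:ℝ)/m < 1 := by linarith
    rwa [div_lt_one hm0] at this
  have hnm : n < m := by exact_mod_cast hnmR
  have hε : (m:ℝ) - n ≤ m / c := by
    have := mul_le_mul_of_nonneg_right hε2 hm0.le
    rw [sub_mul, div_mul_cancel₀ _ hm0.ne'] at this
    calc (m:ℝ) - n = 1 * m - n := by ring
      _ ≤ 1 / c * m := this
      _ = m / c := by ring
  have h1000 : (m:ℝ) - n ≤ m / 1000 := hε.trans (by gcongr)
  have hN : 999 * m ≤ 1000 * n := by
    have : (999:ℝ) * m ≤ 1000 * n := by linarith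
    exact_mod_cast this
  set R := Finset.Icc ((n + 3) / 4) (n / 2) with hRdef
  set L := Nat.log 2 m - 4 with hL
  have hpow : ∀ i < L, 32 * 2^i ≤ m := by
    intro i hi
    have h1 : 2^(i+5) ≤ 2^(Nat.log 2 m) := Nat.pow_le_pow_right (by norm_num) (by omega)
    have h2 := Nat.pow_log_le_self 2 (x := m) (by omega)
    rw [pow_add] at h1
    omega
  have hRr : ∀ r ∈ R, ∀ i < L, 2*2^i ≤ r ∧ r + 8*2^i ≤ n+1 := by
    intro r hr i hi
    rw [hRdef, Finset.mem_Icc] at hr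
    have := hpow i hi
    omega
  have hR1 : ∀ r ∈ R, 1 ≤ r ∧ r ≤ n+1 := by
    intro r hr
    rw [hRdef, Finset.mem_Icc] at hr
    omega
  have hcard : (m:ℝ)/5 ≤ R.card := by
    have : m ≤ 5 * R.card := by
      rw [hRdef, Nat.card_Icc]; omega
    have : (m:ℝ) ≤ 5 * R.card := by exact_mod_cast this
    linarith
  have hc0 : (0:ℝ) < R.card := by linarith
  have hf : ∀ j : ℕ, 0 ≤ 1 / (DeltaExp c Mo j + 1 / (j:ℝ)) := by
    intro j
    have := DeltaExp_nonneg c Mo j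
    positivity
  have hsmall : ∀ j : ℕ, 0 < j → 1 / (DeltaExp c Mo j + 1 / (j:ℝ)) ≤ j := by
    intro j hj
    have := DeltaExp_nonneg c Mo j
    have hjR : (0:ℝ) < j := by exact_mod_cast hj
    rw [div_le_iff₀ (by positivity), mul_add, mul_one_div_cancel hjR.ne']
    nlinarith
  have hJ := Jset_sum m (fun j => 1 / (DeltaExp c Mo j + 1 / (j:ℝ))) hf
  have s2 := hsmall 2 (by norm_num)
  have s4 := hsmall 4 (by norm_num)
  have hbig : (R.card : ℝ) * ∑ i ∈ Finset.range L,
      1 / (DeltaExp c Mo (8*2^i) + 1 / ((8*2^i : ℕ):ℝ)) ≤ 368 * (12 * ∑ r ∈ R, expPairCost Mo r) := by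
    rw [Finset.mul_sum]
    calc _ ≤ ∑ i ∈ Finset.range L, 368 * ∑ r ∈ R, ∑ d ∈ Finset.Ico (2^i) (2*2^i),
          (pIns Mo (2^i) r d + pDel Mo (2^i) r d) := by
          apply Finset.sum_le_sum
          intro i hi
          exact scale_bound Mo c R (2^i) Nat.one_le_two_pow (by omega) hc hnm hε
            (fun r hr => hRr r hr i (Finset.mem_range.1 hi)) hcard
      _ = 368 * ∑ r ∈ R, ∑ i ∈ Finset.range L, ∑ d ∈ Finset.Ico (2^i) (2*2^i),
          (pIns Mo (2^i) r d + pDel Mo (2^i) r d) := by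
          rw [← Finset.mul_sum, Finset.sum_comm]
      _ ≤ _ := by
          apply mul_le_mul_of_nonneg_left _ (by norm_num)
          rw [Finset.mul_sum]
          apply Finset.sum_le_sum
          intro r hr
          exact sum_crit_le Mo r L (hRr r hr) (hR1 r hr).1 (hR1 r hr).2
  have hone : (R.card : ℝ) ≤ ∑ r ∈ R, expPairCost Mo r := by
    have := Finset.card_nsmul_le_sum R (fun r => expPairCost Mo r) 1
      (fun r hr => cost_ge_one Mo r (hR1 r hr).1 (hR1 r hr).2)
    simpa using this
  rw [one_div_mul_eq_div (R.card : ℝ), le_div_iff₀ hc0]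
  have hJ2 := mul_le_mul_of_nonneg_left hJ hc0.le
  rw [mul_add] at hJ2
  have h6 : (R.card:ℝ) * (1 / (DeltaExp c Mo 2 + 1 / ((2:ℕ):ℝ)) + 1 / (DeltaExp c Mo 4 + 1 / ((4:ℕ):ℝ)))
      ≤ R.card * 6 := by
    apply mul_le_mul_of_nonneg_left _ hc0.le
    push_cast at s2 s4 ⊢
    linarith
  linarith
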